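/- Let k ≥ 2, let 1 ≤ a ≤ k, and let π be a set partition of [n] with n ≥ k. Then π contains β_{k,a} if and only if π has a block B and there exists c ∈ [n] with c ∉ B such that |{x ∈ B : x < c}| ≥ a−1 and |{x ∈ B : x > c}| ≥ k−a. -/

import Mathlib

open Finset

/-- The ground set `[n] = {1, …, n}`. -/
def Idx (n : ℕ) : Finset ℕ := Finset.Icc 1 n

/-- `i` and `j` lie in the same block of the set partition `π`. -/
def SameBlock {n : ℕ} (π : Finpartition (Idx n)) (i j : ℕ) : Prop :=
  ∃ B ∈ π.parts, i ∈ B ∧ j ∈ B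

/-- Klazar containment: `σ ⊢ [n]` contains `τ ⊢ [k]` if there is a strictly increasing
map `f : [k] → [n]` such that `i, j` are in the same block of `τ` iff `f i, f j` are in
the same block of `σ`. -/
def Contains {k n : ℕ} (τ : Finpartition (Idx k)) (σ : Finpartition (Idx n)) : Prop :=
  ∃ f : ℕ → ℕ, StrictMonoOn f (Idx k) ∧ (∀ i ∈ Idx k, f i ∈ Idx n) ∧
    ∀ i ∈ Idx k, ∀ j ∈ Idx k, (SameBlock τ i j ↔ SameBlock σ (f i) (f j))

/-- `σ` avoids the pattern `τ`. -/
def Avoids {k n : ℕ} (σ : Finpartition (Idx n)) (τ : Finpartition (Idx k)) : Prop :=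
  ¬ Contains τ σ

/-- `|Π_n(τ)|`, the number of set partitions of `[n]` avoiding `τ`. -/
noncomputable def avoidCount (n : ℕ) {k : ℕ} (τ : Finpartition (Idx k)) : ℕ :=
  Nat.card {σ : Finpartition (Idx n) // Avoids σ τ}

theorem sameBlock_iff_mem {n : ℕ} {π : Finpartition (Idx n)} {B : Finset ℕ}
    (hB : B ∈ π.parts) {x y : ℕ} (hx : x ∈ B) : SameBlock π x y ↔ y ∈ B := by
  constructor
  · rintro ⟨C, hC, hxC, hyC⟩
    rwa [π.eq_of_mem_parts hB hC hx hxC]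
  · exact fun hy => ⟨B, hB, hx, hy⟩

theorem SameBlock.symm {n : ℕ} {π : Finpartition (Idx n)} {x y : ℕ}
    (h : SameBlock π x y) : SameBlock π y x :=
  let ⟨B, hB, hx, hy⟩ := h
  ⟨B, hB, hy, hx⟩

theorem SameBlock.refl {n : ℕ} (π : Finpartition (Idx n)) {x : ℕ} (hx : x ∈ Idx n) :
    SameBlock π x x :=
  let ⟨B, hB, hxB⟩ := π.exists_mem hx
  ⟨B, hB, hxB, hxB⟩

/-- In a partition of `[k]` into `{a}` and its complement, two elements are in the same block
iff both or neither of them equal `a`. -/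
theorem sameBlock_singleton_compl_iff {k a : ℕ} {β : Finpartition (Idx k)}
    (hβ : β.parts = {{a}, Idx k \ {a}}) {i j : ℕ} (hi : i ∈ Idx k) (hj : j ∈ Idx k) :
    SameBlock β i j ↔ (i = a ↔ j = a) := by
  simp only [SameBlock, hβ, mem_insert, mem_singleton, exists_eq_or_imp, exists_eq_left,
    mem_sdiff, hi, hj, true_and]
  tauto

/-- The increasing enumeration of a finite set of naturals, restricted to its first `m`
elements. -/
theorem exists_strictMonoOn_mapsTo (s : Finset ℕ) {m : ℕ} (hm : m ≤ s.card) :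
    ∃ g : ℕ → ℕ, (∀ i j, i < j → j < m → g i < g j) ∧ ∀ i < m, g i ∈ s := by
  have hf : (Set.ofPred (· ∈ s)).Finite := s.finite_toSet
  have hc : hf.toFinset.card = s.card := by
    congr 1
    ext x
    exact hf.mem_toFinset
  refine ⟨Nat.nth (· ∈ s), fun i j hij hj => ?_, fun i hi => ?_⟩
  · exact Nat.nth_lt_nth_of_lt_card hf hij (hj.trans_le (hm.trans_eq hc.symm))
  · exact Nat.nth_mem_of_lt_card hf (hi.trans_le (hm.trans_eq hc.symm))

/-- `π ⊢ [n]` contains `β_{k,a}` iff some block `B` of `π` has, for some `c ∈ [n]` with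
`c ∉ B`, at least `a - 1` elements below `c` and at least `k - a` elements above `c`. -/
theorem contains_beta_iff (k a n : ℕ) (hk : 2 ≤ k) (ha : 1 ≤ a) (hak : a ≤ k)
    (hkn : k ≤ n) (β : Finpartition (Idx k))
    (hβ : β.parts = {{a}, Idx k \ {a}})
    (π : Finpartition (Idx n)) :
    Contains β π ↔ ∃ B ∈ π.parts, ∃ c ∈ Idx n, c ∉ B ∧
      a - 1 ≤ (B.filter (fun x => x < c)).card ∧
      k - a ≤ (B.filter (fun x => c < x)).card := by
  constructor
  · rintro ⟨f, hf, hfn, hs⟩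
    have haI : a ∈ Idx k := by simp [Idx]; omega
    obtain ⟨b, hb, hba⟩ : ∃ b ∈ Idx k, b ≠ a := by
      by_cases h : a = 1
      · exact ⟨2, by simp [Idx]; omega, by omega⟩
      · exact ⟨1, by simp [Idx]; omega, by omega⟩
    obtain ⟨B, hB, hbB⟩ := π.exists_mem (hfn b hb)
    have key : ∀ j ∈ Idx k, f j ∈ B ↔ j ≠ a := fun j hj => by
      rw [← sameBlock_iff_mem hB hbB, ← hs b hb j hj, sameBlock_singleton_compl_iff hβ hb hj]
      tauto
    refine ⟨B, hB, f a, hfn a haI, fun h => (key a haI).1 h rfl, ?_, ?_⟩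
    · have hsub : ∀ i ∈ Icc 1 (a - 1), i ∈ Idx k ∧ i < a := fun i hi => by
        simp only [Idx, mem_Icc] at hi ⊢
        omega
      calc a - 1 = (Icc 1 (a - 1)).card := by simp
        _ ≤ _ := card_le_card_of_injOn f
          (fun i hi => by
            obtain ⟨hik, hia⟩ := hsub i hi
            exact mem_filter.2 ⟨(key i hik).2 hia.ne, hf hik haI hia⟩)
          (hf.injOn.mono fun i hi => (hsub i hi).1)
    · have hsub : ∀ i ∈ Icc (a + 1) k, i ∈ Idx k ∧ a < i := fun i hi => by
        simp only [Idx, mem_Icc] at hi ⊢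
        omega
      calc k - a = (Icc (a + 1) k).card := by simp
        _ ≤ _ := card_le_card_of_injOn f
          (fun i hi => by
            obtain ⟨hik, hia⟩ := hsub i hi
            exact mem_filter.2 ⟨(key i hik).2 hia.ne', hf haI hik hia⟩)
          (hf.injOn.mono fun i hi => (hsub i hi).1)
  · rintro ⟨B, hB, c, hc, hcB, hL, hU⟩
    obtain ⟨g, hg, hgB⟩ := exists_strictMonoOn_mapsTo _ hL
    obtain ⟨u, hu, huB⟩ := exists_strictMonoOn_mapsTo _ hU
    simp only [mem_filter] at hgB huB
    let f : ℕ → ℕ := fun i => if i < a then g (i - 1) else if i = a then c else u (i - a - 1)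
    have f_lt : ∀ i, i < a → f i = g (i - 1) := fun i h => if_pos h
    have f_a : f a = c := by simp [f]
    have f_gt : ∀ i, a < i → f i = u (i - a - 1) := fun i h => by
      simp [f, h.not_gt, h.ne']
    have below : ∀ i ∈ Idx k, i < a → f i ∈ B ∧ f i < c := fun i hi h => by
      simp only [Idx, mem_Icc] at hi
      rw [f_lt i h]
      exact hgB _ (by omega)
    have above : ∀ i ∈ Idx k, a < i → f i ∈ B ∧ c < f i := fun i hi h => by
      simp only [Idx, mem_Icc] at hi
      rw [f_gt i h]
      exact huB _ (by omega)
    have f_mem : ∀ i ∈ Idx k, i ≠ a → f i ∈ B := fun i hi h =>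
      h.lt_or_gt.elim (fun h => (below i hi h).1) (fun h => (above i hi h).1)
    have f_Idx : ∀ i ∈ Idx k, f i ∈ Idx n := fun i hi => by
      by_cases h : i = a
      · rwa [h, f_a]
      · exact π.le hB (f_mem i hi h)
    refine ⟨f, fun i hi j hj hij => ?_, f_Idx, fun i hi j hj => ?_⟩
    · have hi' : i ∈ Idx k := hi
      have hj' : j ∈ Idx k := hj
      simp only [Idx, mem_Icc] at hi' hj'
      rcases lt_trichotomy i a with hia | rfl | hia
      · rcases lt_trichotomy j a with hja | rfl | hja
        · rw [f_lt i hia, f_lt j hja]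
          exact hg _ _ (by omega) (by omega)
        · exact f_a ▸ (below i hi hia).2
        · exact (below i hi hia).2.trans (above j hj hja).2
      · rw [f_a]
        exact (above j hj hij).2
      · rw [f_gt i hia, f_gt j (hia.trans hij)]
        exact hu _ _ (by omega) (by omega)
    · rw [sameBlock_singleton_compl_iff hβ hi hj]
      by_cases hia : i = a
      · by_cases hja : j = a
        · simpa [hia, hja] using SameBlock.refl π (f_Idx a (hia ▸ hi))
        · refine iff_of_false (by tauto) fun h => hcB ?_
          rw [← f_a, ← hia]
          exact (sameBlock_iff_mem hB (f_mem j hj hja)).1 h.symm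
      · rw [sameBlock_iff_mem hB (f_mem i hi hia)]
        by_cases hja : j = a
        · simp [hia, hja, f_a, hcB]
        · simp [hia, hja, f_mem j hj hja]
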